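/- Let G be a finite simple connected non-bipartite graph on n vertices, and let μ ∈ [0,1) be such that every eigenvalue of Â_r = Â − z₁z₁ᵀ lies in [−μ, μ]. Consider a GNN of depth r with ‖∇φ_l‖ ≤ α and max{‖∇ψ_l‖, 1} ≤ β for all l. Set d_min = min_{v∈V} d_v and d_max = max_{v∈V} d_v. Then the sum over all ordered pairs of distinct vertices u ≠ v of ‖∂h_u^{(r)}/∂x_v‖ is at most (2αβ)^r · (d_max/2) · ( (n(n−1)/d_min)·( r + 1 + μ^{r+1}/(1−μ) ) − R_tot ), where R_tot is the total resistance of G. -/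

import Mathlib

open Matrix Finset

/-- The normalized adjacency matrix `Â = D^{-1/2} A D^{-1/2}` of a graph. -/
noncomputable def nadj {V : Type*} [Fintype V] [DecidableEq V] (G : SimpleGraph V)
    [DecidableRel G.Adj] : Matrix V V ℝ :=
  Matrix.diagonal (fun v => (Real.sqrt (G.degree v))⁻¹) * G.adjMatrix ℝ *
    Matrix.diagonal (fun v => (Real.sqrt (G.degree v))⁻¹)

/-- The unit eigenvector `z₁` of `Â` with eigenvalue `1`: `z₁(v) = √(d_v/(2m))`. -/
noncomputable def zOne {V : Type*} [Fintype V] [DecidableEq V] (G : SimpleGraph V)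
    [DecidableRel G.Adj] : V → ℝ :=
  fun v => Real.sqrt ((G.degree v : ℝ) / (2 * (G.edgeFinset.card : ℝ)))

/-- `Â_r = Â − z₁z₁ᵀ`, the restriction of `Â` to the orthogonal complement of `z₁`. -/
noncomputable def nadjr {V : Type*} [Fintype V] [DecidableEq V] (G : SimpleGraph V)
    [DecidableRel G.Adj] : Matrix V V ℝ :=
  nadj G - Matrix.vecMulVec (zOne G) (zOne G)

/-- The effective resistance `R_{u,v} = (1_u − 1_v)ᵀ (L + (1/n)J)⁻¹ (1_u − 1_v)`. -/
noncomputable def effRes {V : Type*} [Fintype V] [DecidableEq V] (G : SimpleGraph V)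
    [DecidableRel G.Adj] (u v : V) : ℝ :=
  (Pi.single u 1 - Pi.single v 1) ⬝ᵥ
    ((G.lapMatrix ℝ + ((Fintype.card V : ℝ))⁻¹ • Matrix.of (fun _ _ : V => (1 : ℝ)))⁻¹ *ᵥ
      (Pi.single u 1 - Pi.single v 1))

/-- The total resistance `R_tot`: the sum of `R_{u,v}` over unordered pairs of distinct
vertices, i.e. half the sum over ordered pairs of distinct vertices. -/
noncomputable def totalRes {V : Type*} [Fintype V] [DecidableEq V] (G : SimpleGraph V)
    [DecidableRel G.Adj] : ℝ :=
  (∑ p ∈ Finset.univ.offDiag, effRes G p.1 p.2) / 2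

/-- The GNN iteration: `h⁰_v(X) = X v` and
`h^{l+1}_v(X) = φ_l (h^l_v(X), Σ_u Â_{uv} ψ_l (h^l_u(X)))`. -/
noncomputable def gnn {V : Type*} [Fintype V] [DecidableEq V] (G : SimpleGraph V)
    [DecidableRel G.Adj] (d : ℕ)
    (φ : ℕ → WithLp 2 (EuclideanSpace ℝ (Fin d) × EuclideanSpace ℝ (Fin d)) →
      EuclideanSpace ℝ (Fin d))
    (ψ : ℕ → EuclideanSpace ℝ (Fin d) → EuclideanSpace ℝ (Fin d)) :
    ℕ → (V → EuclideanSpace ℝ (Fin d)) → V → EuclideanSpace ℝ (Fin d)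
  | 0, X, v => X v
  | (l + 1), X, v =>
      φ l ((WithLp.equiv 2 _).symm
        (gnn G d φ ψ l X v, ∑ u : V, nadj G u v • ψ l (gnn G d φ ψ l X u)))

/-- Entrywise nonnegativity passes to matrix powers. -/
lemma matrix_pow_apply_nonneg {V : Type*} [Fintype V] [DecidableEq V] {B : Matrix V V ℝ}
    (hB : ∀ u v, 0 ≤ B u v) (l : ℕ) (u v : V) : 0 ≤ (B ^ l) u v := by
  induction l generalizing v with
  | zero => rw [pow_zero, Matrix.one_apply]; split_ifs <;> norm_num
  | succ l ih =>
    rw [pow_succ, Matrix.mul_apply]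
    exact Finset.sum_nonneg fun w _ => mul_nonneg (ih w) (hB w v)

/-- A nonnegative matrix fixing a positive vector has all powers with diagonal entries at most one. -/
lemma matrix_pow_diag_le_one {V : Type*} [Fintype V] [DecidableEq V] {B : Matrix V V ℝ}
    (hB : ∀ u v, 0 ≤ B u v) {s : V → ℝ} (hs : ∀ v, 0 < s v) (hBs : B *ᵥ s = s)
    (l : ℕ) (u : V) : (B ^ l) u u ≤ 1 := by
  have hfix : (B ^ l) *ᵥ s = s := by
    induction l with
    | zero => simp
    | succ l ih => rw [pow_succ, ← Matrix.mulVec_mulVec, hBs, ih]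
  have hle : (B ^ l) u u * s u ≤ s u := by
    calc (B ^ l) u u * s u ≤ ∑ w, (B ^ l) u w * s w :=
          Finset.single_le_sum
            (fun w _ => mul_nonneg (matrix_pow_apply_nonneg hB l u w) (hs w).le)
            (Finset.mem_univ u)
      _ = s u := congrFun hfix u
  exact (mul_le_iff_le_one_left (hs u)).mp hle

/-- Off the diagonal, `(1 + B)^r` is at most `2^(r-1)` times the sum of the powers of `B`. -/
lemma two_mul_one_add_pow_apply_le {V : Type*} [Fintype V] [DecidableEq V] {B : Matrix V V ℝ}
    (hB : ∀ u v, 0 ≤ B u v) (r : ℕ) {u v : V} (huv : u ≠ v) :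
    2 * ((1 + B) ^ r) u v ≤ 2 ^ r * ∑ l ∈ Finset.range (r + 1), (B ^ l) u v := by
  rcases r with _ | r
  · simp [Matrix.one_apply_ne huv]
  rw [add_comm, (Commute.one_right B).add_pow, Matrix.sum_apply, Finset.mul_sum, Finset.mul_sum]
  refine Finset.sum_le_sum fun l _ => ?_
  have hchoose : (r + 1).choose l ≤ 2 ^ r := by
    rcases l with _ | l
    · simpa using Nat.one_le_two_pow
    · rcases Nat.lt_or_ge r (l + 1) with h | h
      · rw [Nat.choose_succ_succ, Nat.choose_eq_zero_of_lt h]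
        exact Nat.choose_le_two_pow _ _
      rw [Nat.choose_succ_succ, ← Nat.sum_range_choose]
      calc r.choose l + r.choose (l + 1) = ∑ i ∈ ({l, l + 1} : Finset ℕ), r.choose i := by
            rw [Finset.sum_pair (by omega)]
        _ ≤ _ := Finset.sum_le_sum_of_subset (by
            intro i hi
            simp only [Finset.mem_insert, Finset.mem_singleton] at hi
            simp only [Finset.mem_range]; omega)
  have hcast : ((r + 1).choose l : ℝ) ≤ 2 ^ r := by exact_mod_cast hchoose
  have hentry : (B ^ l * 1 ^ (r + 1 - l) * ((r + 1).choose l : Matrix V V ℝ)) u v =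
      (B ^ l) u v * (r + 1).choose l := by
    rw [one_pow, mul_one, ← nsmul_eq_mul', Matrix.smul_apply, nsmul_eq_mul, mul_comm]
  rw [hentry, pow_succ]
  nlinarith [mul_le_mul_of_nonneg_left hcast (matrix_pow_apply_nonneg hB l u v)]

/-- A symmetric real matrix with eigenvalues in `[-μ, μ]` has Euclidean operator norm at most `μ`. -/
lemma norm_toLp_mulVec_le_of_eigenvalues {V : Type*} [Fintype V] [DecidableEq V]
    {B : Matrix V V ℝ} (hB : B.IsHermitian) {μ : ℝ} (hμ0 : 0 ≤ μ)
    (hspec : ∀ t : ℝ, Module.End.HasEigenvalue (Matrix.mulVecLin B) t → |t| ≤ μ) (w : V → ℝ) :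
    ‖WithLp.toLp 2 (B *ᵥ w)‖ ≤ μ * ‖WithLp.toLp 2 w‖ := by
  set b := hB.eigenvectorBasis
  have hev : ∀ i, |hB.eigenvalues i| ≤ μ := fun i => by
    refine hspec _ (Module.End.hasEigenvalue_of_hasEigenvector (x := (b i).ofLp) ⟨?_, ?_⟩)
    · rw [Module.End.mem_eigenspace_iff]
      exact hB.mulVec_eigenvectorBasis i
    · intro h
      have := b.orthonormal.ne_zero i
      exact this (by ext j; exact congrFun h j)
  have hsymm := (Matrix.isSymmetric_toEuclideanLin_iff.mpr hB)
  have hcoef : ∀ i, inner ℝ (b i) (WithLp.toLp 2 (B *ᵥ w)) =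
      hB.eigenvalues i * inner ℝ (b i) (WithLp.toLp 2 w) := fun i => by
    have h := hsymm (b i) (WithLp.toLp 2 w)
    have h2 : Matrix.toEuclideanLin B (b i) = hB.eigenvalues i • b i := by
      ext j; exact congrFun (hB.mulVec_eigenvectorBasis i) j
    rw [h2, real_inner_smul_left] at h
    exact h.symm
  refine le_of_sq_le_sq ?_ (by positivity)
  rw [mul_pow, ← b.sum_sq_norm_inner_right, ← b.sum_sq_norm_inner_right, Finset.mul_sum]
  refine Finset.sum_le_sum fun i _ => ?_
  rw [hcoef, norm_mul, mul_pow]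
  exact mul_le_mul_of_nonneg_right (pow_le_pow_left₀ (norm_nonneg _) (hev i) 2) (by positivity)

/-- Truncated Neumann expansion of `w ⬝ x` for a solution of `(1 - B) w = x`. -/
lemma dotProduct_le_neumann {V : Type*} [Fintype V] [DecidableEq V] {B : Matrix V V ℝ} {μ : ℝ}
    (hμ0 : 0 ≤ μ) (hμ1 : μ < 1) {w x : V → ℝ} (hx : w - B *ᵥ w = x)
    (hdecay : ∀ k, ‖WithLp.toLp 2 ((B ^ k) *ᵥ w)‖ ≤ μ ^ k * ‖WithLp.toLp 2 w‖) (r : ℕ) :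
    x ⬝ᵥ w ≤ x ⬝ᵥ ((∑ l ∈ Finset.range (r + 1), B ^ l) *ᵥ x) +
      μ ^ (r + 1) / (1 - μ) * (x ⬝ᵥ x) := by
  have h1μ : 0 < 1 - μ := by linarith
  have hexp : w = (∑ l ∈ Finset.range (r + 1), B ^ l) *ᵥ x + (B ^ (r + 1)) *ᵥ w := by
    have hx' : x = (1 - B) *ᵥ w := by rw [Matrix.sub_mulVec, Matrix.one_mulVec, hx]
    rw [hx', Matrix.mulVec_mulVec, geom_sum_mul_neg, Matrix.sub_mulVec, Matrix.one_mulVec]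
    abel
  have hwx : ‖WithLp.toLp 2 w‖ ≤ ‖WithLp.toLp 2 x‖ / (1 - μ) := by
    rw [le_div_iff₀ h1μ]
    have h1 := hdecay 1
    rw [pow_one, pow_one] at h1
    have h2 : ‖WithLp.toLp 2 w‖ ≤ ‖WithLp.toLp 2 x‖ + ‖WithLp.toLp 2 (B *ᵥ w)‖ := by
      refine le_trans (le_of_eq ?_) (norm_add_le _ _)
      rw [← WithLp.toLp_add, ← hx, sub_add_cancel]
    nlinarith
  have hxx : ‖WithLp.toLp 2 x‖ * ‖WithLp.toLp 2 x‖ = x ⬝ᵥ x := by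
    rw [← real_inner_self_eq_norm_mul_norm, EuclideanSpace.inner_toLp_toLp, star_trivial]
  have htail : x ⬝ᵥ ((B ^ (r + 1)) *ᵥ w) ≤ μ ^ (r + 1) / (1 - μ) * (x ⬝ᵥ x) := by
    have hcs := real_inner_le_norm (WithLp.toLp 2 ((B ^ (r + 1)) *ᵥ w)) (WithLp.toLp 2 x)
    rw [EuclideanSpace.inner_toLp_toLp, star_trivial] at hcs
    calc x ⬝ᵥ ((B ^ (r + 1)) *ᵥ w)
        ≤ ‖WithLp.toLp 2 ((B ^ (r + 1)) *ᵥ w)‖ * ‖WithLp.toLp 2 x‖ := hcs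
      _ ≤ μ ^ (r + 1) * (‖WithLp.toLp 2 x‖ / (1 - μ)) * ‖WithLp.toLp 2 x‖ :=
          mul_le_mul_of_nonneg_right ((hdecay _).trans
            (mul_le_mul_of_nonneg_left hwx (pow_nonneg hμ0 _))) (norm_nonneg _)
      _ = μ ^ (r + 1) / (1 - μ) * (x ⬝ᵥ x) := by rw [← hxx]; ring
  have hsplit := congrArg (x ⬝ᵥ ·) hexp
  simp only [dotProduct_add] at hsplit
  linarith

/-- Jacobian bound for one message-passing layer. -/
lemma norm_fderiv_layer_le {V E : Type*} [Fintype V] [NormedAddCommGroup E] [NormedSpace ℝ E]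
    {f : WithLp 2 (E × E) → E} {g : E → E} {α β : ℝ} (hfdiff : Differentiable ℝ f)
    (hgdiff : Differentiable ℝ g) (hf : ∀ p, ‖fderiv ℝ f p‖ ≤ α) (hg : ∀ p, ‖fderiv ℝ g p‖ ≤ β)
    (hα : 0 ≤ α) (hβ : 1 ≤ β) {a : V → ℝ} (ha : ∀ u, 0 ≤ a u) {h : V → E → E} {y : E}
    (hh : ∀ u, DifferentiableAt ℝ (h u) y) {c : V → ℝ} (hc : ∀ u, ‖fderiv ℝ (h u) y‖ ≤ c u)
    (v : V) :
    DifferentiableAt ℝ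
      (fun y => f ((WithLp.equiv 2 _).symm (h v y, ∑ u, a u • g (h u y)))) y ∧
    ‖fderiv ℝ (fun y => f ((WithLp.equiv 2 _).symm (h v y, ∑ u, a u • g (h u y)))) y‖ ≤
      α * β * (c v + ∑ u, a u * c u) := by
  set e := (WithLp.prodContinuousLinearEquiv 2 ℝ E E).symm.toContinuousLinearMap
  set S : E →L[ℝ] E := ∑ u, a u • (fderiv ℝ g (h u y)).comp (fderiv ℝ (h u) y)
  have hS : HasFDerivAt (fun y => ∑ u, a u • g (h u y)) S y :=
    HasFDerivAt.fun_sum fun u _ =>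
      (((hgdiff (h u y)).hasFDerivAt.comp y (hh u).hasFDerivAt).const_smul (a u))
  have hpair : HasFDerivAt (fun y => e (h v y, ∑ u, a u • g (h u y)))
      (e.comp ((fderiv ℝ (h v) y).prod S)) y :=
    e.hasFDerivAt.comp y ((hh v).hasFDerivAt.prodMk hS)
  have htotal := (hfdiff (e (h v y, ∑ u, a u • g (h u y)))).hasFDerivAt.comp y hpair
  refine ⟨htotal.differentiableAt, ?_⟩
  have hc0 : ∀ u, 0 ≤ c u := fun u => (norm_nonneg _).trans (hc u)
  have hSnorm : ‖S‖ ≤ ∑ u, a u * (β * c u) := by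
    refine (norm_sum_le _ _).trans (Finset.sum_le_sum fun u _ => ?_)
    rw [norm_smul, Real.norm_of_nonneg (ha u)]
    refine mul_le_mul_of_nonneg_left ((ContinuousLinearMap.opNorm_comp_le _ _).trans ?_) (ha u)
    exact mul_le_mul (hg _) (hc u) (norm_nonneg _) (by linarith)
  have hpairnorm : ‖e.comp ((fderiv ℝ (h v) y).prod S)‖ ≤ ‖fderiv ℝ (h v) y‖ + ‖S‖ := by
    refine ContinuousLinearMap.opNorm_le_bound _ (by positivity) fun x => ?_
    have h1 : ‖e (fderiv ℝ (h v) y x, S x)‖ ≤ ‖fderiv ℝ (h v) y x‖ + ‖S x‖ := by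
      rw [WithLp.prod_norm_eq_of_L2]
      refine Real.sqrt_le_iff.mpr ⟨by positivity, ?_⟩
      change ‖fderiv ℝ (h v) y x‖ ^ 2 + ‖S x‖ ^ 2 ≤ _
      nlinarith [norm_nonneg (fderiv ℝ (h v) y x), norm_nonneg (S x)]
    refine h1.trans ?_
    rw [add_mul]
    exact add_le_add (ContinuousLinearMap.le_opNorm _ _) (ContinuousLinearMap.le_opNorm _ _)
  have hfd := htotal.fderiv
  refine (congrArg norm hfd).trans_le ((ContinuousLinearMap.opNorm_comp_le _ _).trans ?_)
  rw [mul_assoc]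
  refine mul_le_mul (hf _) (hpairnorm.trans ?_) (norm_nonneg _) hα
  rw [mul_add, Finset.mul_sum]
  refine add_le_add ((hc v).trans (le_mul_of_one_le_left (hc0 v) hβ)) (hSnorm.trans_eq ?_)
  exact Finset.sum_congr rfl fun u _ => by ring

section Graph

variable {V : Type*} [Fintype V] [DecidableEq V] (G : SimpleGraph V) [DecidableRel G.Adj]

lemma nadj_apply (u v : V) : nadj G u v =
    (Real.sqrt (G.degree u))⁻¹ * G.adjMatrix ℝ u v * (Real.sqrt (G.degree v))⁻¹ := by
  rw [nadj, Matrix.mul_diagonal, Matrix.diagonal_mul]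

lemma nadj_nonneg (u v : V) : 0 ≤ nadj G u v := by
  rw [nadj_apply, SimpleGraph.adjMatrix_apply]
  split_ifs <;> positivity

lemma nadj_symm (u v : V) : nadj G u v = nadj G v u := by
  rw [nadj_apply, nadj_apply, (G.isSymm_adjMatrix (α := ℝ)).apply v u]
  ring

/-- The Jacobian of a GNN is dominated entrywise by `(αβ)^r (1 + Â)^r`. -/
lemma norm_fderiv_gnn_le (d : ℕ)
    (φ : ℕ → WithLp 2 (EuclideanSpace ℝ (Fin d) × EuclideanSpace ℝ (Fin d)) →
      EuclideanSpace ℝ (Fin d))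
    (ψ : ℕ → EuclideanSpace ℝ (Fin d) → EuclideanSpace ℝ (Fin d))
    (α β : ℝ)
    (hφdiff : ∀ l, Differentiable ℝ (φ l))
    (hψdiff : ∀ l, Differentiable ℝ (ψ l))
    (hφ : ∀ l p, ‖fderiv ℝ (φ l) p‖ ≤ α)
    (hψ : ∀ l p, ‖fderiv ℝ (ψ l) p‖ ≤ β)
    (hα : 0 ≤ α) (hβ : 1 ≤ β)
    (X : V → EuclideanSpace ℝ (Fin d)) (v : V) (y : EuclideanSpace ℝ (Fin d)) (r : ℕ) (u : V) :
    DifferentiableAt ℝ (fun y => gnn G d φ ψ r (Function.update X v y) u) y ∧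
    ‖fderiv ℝ (fun y => gnn G d φ ψ r (Function.update X v y) u) y‖ ≤
      (α * β) ^ r * ((1 + nadj G) ^ r) u v := by
  induction r generalizing u with
  | zero =>
    rcases eq_or_ne u v with rfl | huv
    · simp only [gnn, Function.update_self]
      exact ⟨differentiableAt_id, by simpa using ContinuousLinearMap.norm_id_le⟩
    · simp [gnn, Function.update_of_ne huv, Matrix.one_apply_ne huv]
  | succ r ih =>
    obtain ⟨h1, h2⟩ := norm_fderiv_layer_le (hφdiff r) (hψdiff r) (hφ r) (hψ r) hα hβ
      (a := fun w => nadj G w u) (fun w => nadj_nonneg G w u) (fun w => (ih w).1)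
      (fun w => (ih w).2) u
    refine ⟨h1, h2.trans_eq ?_⟩
    rw [pow_succ' (1 + nadj G), Matrix.add_mul, Matrix.one_mul, Matrix.add_apply,
      Matrix.mul_apply, pow_succ (α * β), mul_add, mul_add, Finset.mul_sum, Finset.mul_sum]
    congr 1
    · ring
    · refine Finset.sum_congr rfl fun w _ => ?_
      simp only [nadj_symm G w u]
      ring

/-- `L = D^{1/2} (1 - Â) D^{1/2}`, in vector form. -/
lemma one_sub_nadj_mulVec_eq (hdeg : ∀ v, 0 < G.degree v) (y : V → ℝ) (v : V) :
    Real.sqrt (G.degree v) * Real.sqrt (G.degree v) * y v -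
      Real.sqrt (G.degree v) * (nadj G *ᵥ fun w => Real.sqrt (G.degree w) * y w) v =
    (G.lapMatrix ℝ *ᵥ y) v := by
  have hpos : ∀ w, Real.sqrt (G.degree w) ≠ 0 := fun w =>
    (Real.sqrt_pos.mpr (Nat.cast_pos.mpr (hdeg w))).ne'
  rw [SimpleGraph.lapMatrix_mulVec_apply, Real.mul_self_sqrt (Nat.cast_nonneg _)]
  congr 1
  rw [← SimpleGraph.adjMatrix_mulVec_apply, Matrix.mulVec, Matrix.mulVec, dotProduct, dotProduct,
    Finset.mul_sum]
  refine Finset.sum_congr rfl fun w _ => ?_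
  rw [nadj_apply]
  have := hpos v
  have := hpos w
  field_simp

lemma nadj_mulVec_sqrt_degree (hdeg : ∀ v, 0 < G.degree v) :
    nadj G *ᵥ (fun v => Real.sqrt (G.degree v)) = fun v => Real.sqrt (G.degree v) := by
  ext v
  have h := one_sub_nadj_mulVec_eq G hdeg (fun _ => 1) v
  rw [SimpleGraph.lapMatrix_mulVec_const_eq_zero] at h
  have hpos : Real.sqrt (G.degree v) ≠ 0 := (Real.sqrt_pos.mpr (Nat.cast_pos.mpr (hdeg v))).ne'
  simp only [mul_one, Pi.zero_apply] at h
  have h' := mul_left_cancel₀ hpos (sub_eq_zero.mp h)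
  exact h'.symm

lemma nadj_isSymm : (nadj G).IsSymm := by
  ext u v; exact nadj_symm G v u

lemma nadjr_isHermitian : (nadjr G).IsHermitian := by
  ext u v
  simp [nadjr, Matrix.vecMulVec_apply, nadj_symm G u v, mul_comm]

/-- The potential solving `L y = 1_u - 1_v` computes the effective resistance. -/
lemma exists_potential_effRes [Nonempty V] (hconn : G.Connected) (u v : V) :
    ∃ y : V → ℝ, G.lapMatrix ℝ *ᵥ y = Pi.single u 1 - Pi.single v 1 ∧
      effRes G u v = (Pi.single u 1 - Pi.single v 1) ⬝ᵥ y := by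
  set n : ℝ := (Fintype.card V : ℝ)
  have hn : n ≠ 0 := by simp [n]
  set M := G.lapMatrix ℝ + n⁻¹ • Matrix.of (fun _ _ : V => (1 : ℝ)) with hM
  have hMapp : ∀ (y : V → ℝ) w, (M *ᵥ y) w = (G.lapMatrix ℝ *ᵥ y) w + n⁻¹ * ∑ i, y i := by
    intro y w
    rw [hM, Matrix.add_mulVec, Matrix.smul_mulVec]
    simp [Matrix.mulVec, dotProduct]
  have hsumL : ∀ y : V → ℝ, ∑ w, (G.lapMatrix ℝ *ᵥ y) w = 0 := by
    intro y
    have h : (fun _ => (1 : ℝ)) ⬝ᵥ (G.lapMatrix ℝ *ᵥ y) = 0 := by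
      rw [Matrix.dotProduct_mulVec, ← Matrix.mulVec_transpose, (G.isSymm_lapMatrix ℝ).eq,
        SimpleGraph.lapMatrix_mulVec_const_eq_zero, zero_dotProduct]
    simpa [dotProduct] using h
  have hsum : ∀ y : V → ℝ, ∑ w, (M *ᵥ y) w = ∑ w, y w := by
    intro y
    simp_rw [hMapp]
    rw [Finset.sum_add_distrib, hsumL, zero_add, Finset.sum_const, Finset.card_univ, nsmul_eq_mul]
    exact mul_inv_cancel_left₀ hn _
  have hinj : Function.Injective M.mulVec := by
    refine (injective_iff_map_eq_zero M.mulVecLin).mpr fun y hy => ?_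
    have hy : M *ᵥ y = 0 := hy
    have hy0 : ∑ w, y w = 0 := by rw [← hsum, hy]; simp
    have hLy : G.lapMatrix ℝ *ᵥ y = 0 := by
      ext w
      have := hMapp y w
      rw [hy, hy0] at this
      simpa using this.symm
    have hconst := (G.lapMatrix_mulVec_eq_zero_iff_forall_reachable).mp hLy
    ext w
    have hall : ∀ i, y i = y w := fun i => hconst i w (hconn.preconnected i w)
    simp_rw [hall] at hy0
    simpa [Finset.sum_const] using hy0
  have hunit : IsUnit M := Matrix.mulVec_injective_iff_isUnit.mp hinj
  set x : V → ℝ := Pi.single u 1 - Pi.single v 1 with hx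
  have hMy : M *ᵥ (M⁻¹ *ᵥ x) = x := by
    rw [Matrix.mulVec_mulVec, Matrix.mul_nonsing_inv _ ((Matrix.isUnit_iff_isUnit_det _).mp hunit),
      Matrix.one_mulVec]
  refine ⟨M⁻¹ *ᵥ x, ?_, rfl⟩
  ext w
  have h0 : ∑ i, (M⁻¹ *ᵥ x) i = 0 := by
    rw [← hsum, hMy]; simp [hx]
  have := hMapp (M⁻¹ *ᵥ x) w
  rw [hMy, h0, mul_zero, add_zero] at this
  exact this.symm

lemma zOne_eq_smul : zOne G =
    (Real.sqrt (2 * G.edgeFinset.card))⁻¹ • fun v => Real.sqrt (G.degree v) := by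
  ext v
  simp [zOne, div_eq_inv_mul]

lemma zOne_dotProduct_self [Nonempty V] (hdeg : ∀ v, 0 < G.degree v) : zOne G ⬝ᵥ zOne G = 1 := by
  have hsum : ∑ v, (G.degree v : ℝ) = 2 * G.edgeFinset.card := by
    exact_mod_cast G.sum_degrees_eq_twice_card_edges
  have hpos : 0 < ∑ v, (G.degree v : ℝ) :=
    Finset.sum_pos (fun v _ => Nat.cast_pos.mpr (hdeg v)) Finset.univ_nonempty
  have hterm : ∀ v, zOne G v * zOne G v = (G.degree v : ℝ) / (2 * G.edgeFinset.card) := fun v =>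
    Real.mul_self_sqrt (by positivity)
  simp_rw [dotProduct, hterm]
  rw [← Finset.sum_div, hsum]
  exact div_self (hsum ▸ hpos).ne'

lemma nadj_mulVec_zOne (hdeg : ∀ v, 0 < G.degree v) : nadj G *ᵥ zOne G = zOne G := by
  rw [zOne_eq_smul, Matrix.mulVec_smul, nadj_mulVec_sqrt_degree G hdeg]

/-- On the orthogonal complement of `z₁`, the powers of `Â` decay at rate `μ`. -/
lemma norm_nadj_pow_mulVec_le (hdeg : ∀ v, 0 < G.degree v) {μ : ℝ} (hμ0 : 0 ≤ μ)
    (hspec : ∀ t : ℝ, Module.End.HasEigenvalue (Matrix.mulVecLin (nadjr G)) t → |t| ≤ μ)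
    {w : V → ℝ} (hw : zOne G ⬝ᵥ w = 0) (k : ℕ) :
    ‖WithLp.toLp 2 ((nadj G ^ k) *ᵥ w)‖ ≤ μ ^ k * ‖WithLp.toLp 2 w‖ := by
  suffices h : zOne G ⬝ᵥ ((nadj G ^ k) *ᵥ w) = 0 ∧
      ‖WithLp.toLp 2 ((nadj G ^ k) *ᵥ w)‖ ≤ μ ^ k * ‖WithLp.toLp 2 w‖ from h.2
  induction k with
  | zero => simp [hw]
  | succ k ih =>
    obtain ⟨ih0, ih1⟩ := ih
    rw [pow_succ', ← Matrix.mulVec_mulVec]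
    constructor
    · rw [Matrix.dotProduct_mulVec, ← Matrix.mulVec_transpose, (nadj_isSymm G).eq,
        nadj_mulVec_zOne G hdeg, ih0]
    · have heq : nadj G *ᵥ ((nadj G ^ k) *ᵥ w) = nadjr G *ᵥ ((nadj G ^ k) *ᵥ w) := by
        rw [nadjr, Matrix.sub_mulVec, Matrix.vecMulVec_mulVec, ih0]
        simp
      rw [heq, pow_succ', mul_assoc]
      exact (norm_toLp_mulVec_le_of_eigenvalues (nadjr_isHermitian G) hμ0 hspec _).trans
        (mul_le_mul_of_nonneg_left ih1 hμ0)

/-- Effective resistance is bounded through the normalized, truncated random walk. -/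
lemma effRes_le_neumann [Nonempty V] (hconn : G.Connected) (hdeg : ∀ v, 0 < G.degree v) {μ : ℝ}
    (hμ0 : 0 ≤ μ) (hμ1 : μ < 1)
    (hspec : ∀ t : ℝ, Module.End.HasEigenvalue (Matrix.mulVecLin (nadjr G)) t → |t| ≤ μ)
    (r : ℕ) (u v : V) {x : V → ℝ}
    (hx : x = Pi.single u (Real.sqrt (G.degree u))⁻¹ - Pi.single v (Real.sqrt (G.degree v))⁻¹) :
    effRes G u v ≤ x ⬝ᵥ ((∑ l ∈ Finset.range (r + 1), nadj G ^ l) *ᵥ x) +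
      μ ^ (r + 1) / (1 - μ) * (x ⬝ᵥ x) := by
  have hpos : ∀ w, Real.sqrt (G.degree w) ≠ 0 := fun w =>
    (Real.sqrt_pos.mpr (Nat.cast_pos.mpr (hdeg w))).ne'
  obtain ⟨y, hLy, hR⟩ := exists_potential_effRes G hconn u v
  set w₀ : V → ℝ := fun w => Real.sqrt (G.degree w) * y w with hw₀
  have hsolve : w₀ - nadj G *ᵥ w₀ = x := by
    ext w
    have h := one_sub_nadj_mulVec_eq G hdeg y w
    rw [hLy] at h
    have hxw : Real.sqrt (G.degree w) * x w = ((Pi.single u 1 - Pi.single v 1 : V → ℝ)) w := by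
      simp only [hx, Pi.sub_apply, mul_sub, Pi.single_apply, mul_ite, mul_zero]
      congr 1 <;> split_ifs with h' <;> first | rfl | rw [← h', mul_inv_cancel₀ (hpos w)]
    refine mul_left_cancel₀ (hpos w) ?_
    rw [hxw, ← h, Pi.sub_apply, hw₀]
    ring
  have hzx : zOne G ⬝ᵥ x = 0 := by
    rw [← hsolve, dotProduct_sub, Matrix.dotProduct_mulVec, ← Matrix.mulVec_transpose,
      (nadj_isSymm G).eq, nadj_mulVec_zOne G hdeg, sub_self]
  have hR' : effRes G u v = x ⬝ᵥ w₀ := by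
    rw [hR, hx, sub_dotProduct, sub_dotProduct]
    simp [hw₀, inv_mul_cancel_left₀ (hpos _)]
  set c := zOne G ⬝ᵥ w₀ with hc
  have hzw : zOne G ⬝ᵥ (w₀ - c • zOne G) = 0 := by
    rw [dotProduct_sub, dotProduct_smul, zOne_dotProduct_self G hdeg, ← hc]
    simp
  have hsolve' : (w₀ - c • zOne G) - nadj G *ᵥ (w₀ - c • zOne G) = x := by
    rw [Matrix.mulVec_sub, Matrix.mulVec_smul, nadj_mulVec_zOne G hdeg, ← hsolve]
    abel
  have hxw : x ⬝ᵥ (w₀ - c • zOne G) = x ⬝ᵥ w₀ := by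
    rw [dotProduct_sub, dotProduct_smul, dotProduct_comm x (zOne G), hzx]
    simp
  rw [hR', ← hxw]
  exact dotProduct_le_neumann hμ0 hμ1 hsolve' (norm_nadj_pow_mulVec_le G hdeg hμ0 hspec hzw) r

/-- Pairwise form of the bound: truncated walk sums against effective resistance. -/
lemma sum_nadj_pow_apply_le [Nonempty V] (hconn : G.Connected) (hdeg : ∀ v, 0 < G.degree v)
    {μ : ℝ} (hμ0 : 0 ≤ μ) (hμ1 : μ < 1)
    (hspec : ∀ t : ℝ, Module.End.HasEigenvalue (Matrix.mulVecLin (nadjr G)) t → |t| ≤ μ)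
    {dmin dmax : ℕ} (hdmin0 : 0 < dmin) (hdmin : ∀ v, dmin ≤ G.degree v)
    (hdmax : ∀ v, G.degree v ≤ dmax) (r : ℕ) {u v : V} (huv : u ≠ v) :
    ∑ l ∈ Finset.range (r + 1), (nadj G ^ l) u v ≤
      (dmax : ℝ) / 2 * (2 / dmin * ((r : ℝ) + 1 + μ ^ (r + 1) / (1 - μ)) - effRes G u v) := by
  set a := (Real.sqrt (G.degree u))⁻¹ with ha
  set b := (Real.sqrt (G.degree v))⁻¹ with hb
  set S := ∑ l ∈ Finset.range (r + 1), nadj G ^ l with hS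
  have hR := effRes_le_neumann G hconn hdeg hμ0 hμ1 hspec r u v rfl
  rw [← ha, ← hb, ← hS] at hR
  have hSapp : ∀ i j, S i j = ∑ l ∈ Finset.range (r + 1), (nadj G ^ l) i j := fun i j => by
    rw [hS, Matrix.sum_apply]
  rw [← hSapp]
  have hSsymm : S v u = S u v := by
    rw [hSapp, hSapp]
    exact Finset.sum_congr rfl fun l _ => ((nadj_isSymm G).pow l).apply u v
  have hS0 : 0 ≤ S u v := by
    rw [hSapp]
    exact Finset.sum_nonneg fun l _ => matrix_pow_apply_nonneg (nadj_nonneg G) l u v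
  have hSdiag : ∀ i, S i i ≤ r + 1 := fun i => by
    rw [hSapp]
    refine (Finset.sum_le_sum fun l _ => matrix_pow_diag_le_one (nadj_nonneg G)
      (fun w => Real.sqrt_pos.mpr (Nat.cast_pos.mpr (hdeg w)))
      (nadj_mulVec_sqrt_degree G hdeg) l i).trans ?_
    simp
  have hquad : (Pi.single u a - Pi.single v b : V → ℝ) ⬝ᵥ
      (S *ᵥ (Pi.single u a - Pi.single v b : V → ℝ)) =
      a ^ 2 * S u u + b ^ 2 * S v v - 2 * (a * b * S u v) := by
    simp only [Matrix.mulVec_sub, sub_dotProduct, dotProduct_sub, single_dotProduct,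
      Matrix.mulVec_single, Pi.smul_apply, Matrix.col_apply, MulOpposite.smul_eq_mul_unop,
      MulOpposite.unop_op, hSsymm]
    ring
  have hself : (Pi.single u a - Pi.single v b : V → ℝ) ⬝ᵥ (Pi.single u a - Pi.single v b : V → ℝ) =
      a ^ 2 + b ^ 2 := by
    simp [dotProduct_sub, huv, huv.symm]
    ring
  rw [hquad, hself] at hR
  have hdminR : (0 : ℝ) < dmin := Nat.cast_pos.mpr hdmin0
  have hsq : ∀ i, ((Real.sqrt (G.degree i))⁻¹) ^ 2 ≤ 1 / (dmin : ℝ) := fun i => by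
    rw [inv_pow, Real.sq_sqrt (Nat.cast_nonneg _), ← one_div]
    exact one_div_le_one_div_of_le hdminR (Nat.cast_le.mpr (hdmin i))
  have hmu : 0 ≤ μ ^ (r + 1) / (1 - μ) := div_nonneg (pow_nonneg hμ0 _) (by linarith)
  have hwalk : 2 * (a * b * S u v) ≤
      2 / dmin * ((r : ℝ) + 1 + μ ^ (r + 1) / (1 - μ)) - effRes G u v := by
    have hK : 0 ≤ (r : ℝ) + 1 + μ ^ (r + 1) / (1 - μ) := by positivity
    have h1 := mul_le_mul_of_nonneg_right (hsq u) hK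
    have h2 := mul_le_mul_of_nonneg_right (hsq v) hK
    have h3 := mul_le_mul_of_nonneg_left (hSdiag u) (sq_nonneg a)
    have h4 := mul_le_mul_of_nonneg_left (hSdiag v) (sq_nonneg b)
    have h5 : (2 : ℝ) / dmin = 1 / dmin + 1 / dmin := by ring
    rw [h5]
    linarith
  have hprod : 1 ≤ dmax * (a * b) := by
    have hu : 0 < Real.sqrt (G.degree u) := Real.sqrt_pos.mpr (Nat.cast_pos.mpr (hdeg u))
    have hv : 0 < Real.sqrt (G.degree v) := Real.sqrt_pos.mpr (Nat.cast_pos.mpr (hdeg v))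
    rw [ha, hb, ← mul_inv, ← div_eq_mul_inv, le_div_iff₀ (mul_pos hu hv), one_mul]
    calc Real.sqrt (G.degree u) * Real.sqrt (G.degree v)
        ≤ Real.sqrt dmax * Real.sqrt dmax :=
          mul_le_mul (Real.sqrt_le_sqrt (Nat.cast_le.mpr (hdmax u)))
            (Real.sqrt_le_sqrt (Nat.cast_le.mpr (hdmax v))) hv.le (Real.sqrt_nonneg _)
      _ = dmax := Real.mul_self_sqrt (Nat.cast_nonneg _)
  calc S u v ≤ dmax * (a * b) * S u v := le_mul_of_one_le_left hS0 hprod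
    _ = dmax / 2 * (2 * (a * b * S u v)) := by ring
    _ ≤ _ := mul_le_mul_of_nonneg_left hwalk (by positivity)

end Graph

/-- total-resistance bound on the total Jacobian of a GNN. For a connected
non-bipartite graph on `n` vertices, if every eigenvalue of `Â_r` lies in `[−μ, μ]` with
`μ ∈ [0,1)`, `‖∇φ_l‖ ≤ α`, `max {‖∇ψ_l‖, 1} ≤ β`, `d_min`/`d_max` the min/max vertex degree,
then `Σ_{u ≠ v} ‖∂h_u^{(r)}/∂x_v‖ ≤
(2αβ)^r · (d_max/2) · ((n(n−1)/d_min)(r + 1 + μ^{r+1}/(1−μ)) − R_tot)`. -/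
theorem total_jacobian_bound_by_total_resistance {V : Type*} [Fintype V] [DecidableEq V]
    (G : SimpleGraph V) [DecidableRel G.Adj]
    (hconn : G.Connected) (hnonbip : ¬ G.Colorable 2) (hcard : 2 ≤ Fintype.card V)
    (μ : ℝ) (hμ0 : 0 ≤ μ) (hμ1 : μ < 1)
    (hspec : ∀ t : ℝ, Module.End.HasEigenvalue (Matrix.mulVecLin (nadjr G)) t → |t| ≤ μ)
    (dmin dmax : ℕ)
    (hdmin : IsLeast (Set.range fun v : V => G.degree v) dmin)
    (hdmax : IsGreatest (Set.range fun v : V => G.degree v) dmax)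
    (d r : ℕ)
    (φ : ℕ → WithLp 2 (EuclideanSpace ℝ (Fin d) × EuclideanSpace ℝ (Fin d)) →
      EuclideanSpace ℝ (Fin d))
    (ψ : ℕ → EuclideanSpace ℝ (Fin d) → EuclideanSpace ℝ (Fin d))
    (α β : ℝ)
    (hφdiff : ∀ l, ContDiff ℝ 1 (φ l))
    (hψdiff : ∀ l, ContDiff ℝ 1 (ψ l))
    (hφ : ∀ l p, ‖fderiv ℝ (φ l) p‖ ≤ α)
    (hψ : ∀ l p, ‖fderiv ℝ (ψ l) p‖ ≤ β)
    (hβ : 1 ≤ β)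
    (X : V → EuclideanSpace ℝ (Fin d)) :
    ∑ p ∈ Finset.univ.offDiag,
        ‖fderiv ℝ (fun y => gnn G d φ ψ r (Function.update X p.2 y) p.1) (X p.2)‖ ≤
      (2 * α * β) ^ r * ((dmax : ℝ) / 2) *
        (((Fintype.card V : ℝ) * ((Fintype.card V : ℝ) - 1) / (dmin : ℝ)) *
            ((r : ℝ) + 1 + μ ^ (r + 1) / (1 - μ)) - totalRes G) := by
  have hα : 0 ≤ α := (norm_nonneg _).trans (hφ 0 0)
  have : Nontrivial V := Fintype.one_lt_card_iff_nontrivial.mp hcard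
  have hdeg : ∀ v, 0 < G.degree v := fun v => hconn.preconnected.degree_pos_of_nontrivial v
  have hmin : ∀ v, dmin ≤ G.degree v := fun v => hdmin.2 ⟨v, rfl⟩
  have hmax : ∀ v, G.degree v ≤ dmax := fun v => hdmax.2 ⟨v, rfl⟩
  have hmin0 : 0 < dmin := by
    obtain ⟨v, hv⟩ := hdmin.1
    exact hv ▸ hdeg v
  set K := (r : ℝ) + 1 + μ ^ (r + 1) / (1 - μ)
  have hpair : ∀ p ∈ (Finset.univ : Finset V).offDiag,
      ‖fderiv ℝ (fun y => gnn G d φ ψ r (Function.update X p.2 y) p.1) (X p.2)‖ ≤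
        (2 * α * β) ^ r * ((dmax : ℝ) / 2) * (K / dmin - effRes G p.1 p.2 / 2) := by
    intro p hp
    have hne : p.1 ≠ p.2 := (Finset.mem_offDiag.mp hp).2.2
    have hJ := (norm_fderiv_gnn_le G d φ ψ α β (fun l => (hφdiff l).differentiable one_ne_zero)
      (fun l => (hψdiff l).differentiable one_ne_zero) hφ hψ hα hβ X p.2 (X p.2) r p.1).2
    have hbinom := two_mul_one_add_pow_apply_le (nadj_nonneg G) r hne
    have hS := sum_nadj_pow_apply_le G hconn hdeg hμ0 hμ1 hspec hmin0 hmin hmax r hne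
    have hαβ : 0 ≤ (α * β) ^ r := by positivity
    calc _ ≤ (α * β) ^ r * ((1 + nadj G) ^ r) p.1 p.2 := hJ
      _ ≤ (α * β) ^ r * (2 ^ r / 2 *
          (dmax / 2 * (2 / dmin * K - effRes G p.1 p.2))) := by
        refine mul_le_mul_of_nonneg_left ?_ hαβ
        have := mul_le_mul_of_nonneg_left hS (show (0 : ℝ) ≤ 2 ^ r by positivity)
        linarith
      _ = _ := by rw [mul_assoc 2 α β, mul_pow]; ring
  refine (Finset.sum_le_sum hpair).trans_eq ?_
  rw [← Finset.mul_sum, Finset.sum_sub_distrib, Finset.sum_const, Finset.offDiag_card,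
    Finset.card_univ, nsmul_eq_mul, Nat.cast_sub (Nat.le_mul_self _), totalRes, Finset.sum_div]
  push_cast
  ring
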